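/- arXiv:1305.2637 — 5 statements merged into one kernel-verified Lean document; each statement's English description precedes it below -/
import Mathlib

section
/- Let G be a finitely generated group acting on a set X. If the Schreier graph of the action of G on X is recurrent, then there exists a mean on the group ⊕_X ℤ/2ℤ of finite subsets of X that is invariant under the restricted wreath product (ℤ/2ℤ) ≀_X G, acting on finite subsets by (g,E)(F) = g(E Δ F). -/
open scoped symmDiff

/-! ### Invariant means and amenability -/

/-- A finitely additive probability mean on the collection of all subsets of `X`,
with values in `[0,1]`. -/
structure IsMean {X : Type*} (μ : Set X → ℝ) : Prop where
  nonneg : ∀ A : Set X, 0 ≤ μ A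
  le_one : ∀ A : Set X, μ A ≤ 1
  total : μ Set.univ = 1
  additive : ∀ A B : Set X, Disjoint A B → μ (A ∪ B) = μ A + μ B

/-- An invariant mean for the action of a group `G` on a set `X`: a finitely additive
mean on the subsets of `X` which is invariant under the action of every `g ∈ G`. -/
def IsInvariantMean (G : Type*) {X : Type*} [Group G] [MulAction G X]
    (μ : Set X → ℝ) : Prop :=
  IsMean μ ∧ ∀ (g : G) (A : Set X), μ ((g • ·) '' A) = μ A

/-- The action of `G` on `X` is amenable if it admits an invariant mean. -/
def AmenableAction (G X : Type*) [Group G] [MulAction G X] : Prop :=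
  ∃ μ : Set X → ℝ, IsInvariantMean G μ

/-- A group is amenable if its action on itself by left multiplication is amenable. -/
def AmenableGroup (G : Type*) [Group G] : Prop :=
  AmenableAction G G

/-! ### Recurrence of Schreier graphs, via the capacity criterion -/

/-- The Dirichlet energy of a finitely supported function `a : X → ℝ` with respect to
the Schreier graph of the action of `G` on `X` defined by a (finite, symmetric)
generating set `S`: the graph with vertex set `X` and an edge from `x` to `g • x` for
each `g ∈ S`. -/
noncomputable def schreierEnergy {G X : Type*} [Group G] [MulAction G X]
    (S : Finset G) (a : X →₀ ℝ) : ℝ :=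
  ∑ᶠ x : X, ∑ g ∈ S, (a x - a (g • x)) ^ 2

/-- Recurrence of the simple random walk on the Schreier graph of the orbit of `x₀`
under the action of `G` (with respect to the finite symmetric generating set `S`),
expressed through the capacity criterion: the simple random walk on a connected
locally finite graph is recurrent if and only if the capacity of a vertex `x₀`
vanishes, i.e. there exist finitely supported functions taking the value `1` at `x₀`
whose Dirichlet energy is arbitrarily small (Woess, "Random walks on infinite
graphs and groups", Theorem 2.12). -/
def SchreierRecurrentAt (G : Type*) {X : Type*} [Group G] [MulAction G X]
    (S : Finset G) (x₀ : X) : Prop :=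
  ∀ ε : ℝ, 0 < ε → ∃ a : X →₀ ℝ,
    (a.support : Set X) ⊆ MulAction.orbit G x₀ ∧ a x₀ = 1 ∧ schreierEnergy S a < ε

/-- `S` is a finite symmetric generating set of `G`. -/
def IsSymmGen {G : Type*} [Group G] (S : Finset G) : Prop :=
  (∀ g ∈ S, g⁻¹ ∈ S) ∧ Subgroup.closure (S : Set G) = ⊤

/-- The amplitude at `F` of the product vector whose factor at `x ∈ T` has coordinates
`cos (θ x)` (for `x ∉ F`) and `sin (θ x)` (for `x ∈ F`). -/
noncomputable def productAmplitude {X : Type*} [DecidableEq X] (T : Finset X) (θ : X → ℝ)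
    (F : Finset X) : ℝ :=
  ∏ x ∈ T, if x ∈ F then Real.sin (θ x) else Real.cos (θ x)

/-- The law of a random subset of `T` containing each `x ∈ T` independently with
probability `sin (θ x) ^ 2`. -/
noncomputable def productMean {X : Type*} [DecidableEq X] (T : Finset X) (θ : X → ℝ)
    (A : Set (Finset X)) : ℝ :=
  ∑ F ∈ T.powerset, A.indicator (fun F => productAmplitude T θ F ^ 2) F

section ProductMean

variable {X : Type*} [DecidableEq X]

theorem sum_productAmplitude_mul (T : Finset X) (θ η : X → ℝ) :
    ∑ F ∈ T.powerset, productAmplitude T θ F * productAmplitude T η F =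
      ∏ x ∈ T, Real.cos (θ x - η x) := by
  have h : ∀ x ∈ T, Real.cos (θ x - η x) =
      Real.sin (θ x) * Real.sin (η x) + Real.cos (θ x) * Real.cos (η x) := by
    intro x _
    rw [Real.cos_sub]
    ring
  rw [Finset.prod_congr rfl h, Finset.prod_add]
  refine Finset.sum_congr rfl fun F hF => ?_
  have hFT : F ⊆ T := Finset.mem_powerset.1 hF
  rw [productAmplitude, productAmplitude, ← Finset.prod_mul_distrib,
    ← Finset.prod_sdiff hFT, mul_comm]
  congr 1
  · refine Finset.prod_congr rfl fun x hx => ?_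
    simp [hx]
  · refine Finset.prod_congr rfl fun x hx => ?_
    simp [(Finset.mem_sdiff.1 hx).2]

theorem sum_productAmplitude_sq (T : Finset X) (θ : X → ℝ) :
    ∑ F ∈ T.powerset, productAmplitude T θ F ^ 2 = 1 := by
  simpa [sq] using sum_productAmplitude_mul T θ θ

theorem isMean_productMean (T : Finset X) (θ : X → ℝ) : IsMean (productMean T θ) where
  nonneg A := Finset.sum_nonneg fun F _ => Set.indicator_nonneg (fun _ _ => sq_nonneg _) F
  le_one A := by
    rw [← sum_productAmplitude_sq T θ]
    exact Finset.sum_le_sum fun F _ => Set.indicator_le_self' (fun _ _ => sq_nonneg _) F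
  total := by simp [productMean, sum_productAmplitude_sq]
  additive A B hAB := by
    simp [productMean, Set.indicator_union_of_disjoint hAB, Finset.sum_add_distrib]

theorem productMean_eq_of_subset {T T' : Finset X} (h : T ⊆ T') {θ : X → ℝ}
    (hθ : ∀ x ∉ T, θ x = 0) (A : Set (Finset X)) :
    productMean T θ A = productMean T' θ A := by
  have hamp : ∀ F ∈ T.powerset, productAmplitude T θ F = productAmplitude T' θ F := by
    intro F hF
    refine Finset.prod_subset h fun x _ hx => ?_
    have hxF : x ∉ F := fun hxF => hx (Finset.mem_powerset.1 hF hxF)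
    simp [hxF, hθ x hx]
  calc productMean T θ A
      = ∑ F ∈ T.powerset, A.indicator (fun F => productAmplitude T' θ F ^ 2) F := by
        refine Finset.sum_congr rfl fun F hF => ?_
        simp only [Set.indicator, hamp F hF]
    _ = productMean T' θ A := by
        refine Finset.sum_subset (Finset.powerset_mono.2 h) fun F hF' hF => ?_
        obtain ⟨x, hxF, hxT⟩ := Finset.not_subset.1 (fun hs => hF (Finset.mem_powerset.2 hs))
        have h0 : productAmplitude T' θ F = 0 :=
          Finset.prod_eq_zero (Finset.mem_powerset.1 hF' hxF) (by simp [hxF, hθ x hxT])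
        simp [Set.indicator, h0]

theorem one_sub_sum_sq_le_prod_cos_sq (T : Finset X) (δ : X → ℝ) :
    1 - ∑ x ∈ T, δ x ^ 2 ≤ (∏ x ∈ T, Real.cos (δ x)) ^ 2 := by
  rw [← Finset.prod_pow]
  have hsin : ∀ x, Real.sin (δ x) ^ 2 ≤ δ x ^ 2 := fun x => Real.sin_sq_le_sq
  induction T using Finset.induction_on with
  | empty => simp
  | insert x T hx ih =>
    rw [Finset.sum_insert hx, Finset.prod_insert hx, Real.cos_sq']
    have h1 : ∏ y ∈ T, Real.cos (δ y) ^ 2 ≤ 1 :=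
      Finset.prod_le_one (fun y _ => sq_nonneg _) fun y _ => Real.cos_sq_le_one _
    nlinarith [hsin x, sq_nonneg (Real.sin (δ x))]

/-- Hellinger estimate for the total variation distance of two product means. -/
theorem sq_productMean_sub_le (T : Finset X) (θ η : X → ℝ) (A : Set (Finset X)) :
    (productMean T θ A - productMean T η A) ^ 2 ≤ 4 * ∑ x ∈ T, (θ x - η x) ^ 2 := by
  set u := productAmplitude T θ
  set v := productAmplitude T η
  set P := ∏ x ∈ T, Real.cos (θ x - η x)
  have huv : ∑ F ∈ T.powerset, u F * v F = P := sum_productAmplitude_mul T θ η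
  have hu : ∑ F ∈ T.powerset, u F ^ 2 = 1 := sum_productAmplitude_sq T θ
  have hv : ∑ F ∈ T.powerset, v F ^ 2 = 1 := sum_productAmplitude_sq T η
  have hdiff : productMean T θ A - productMean T η A =
      ∑ F ∈ T.powerset, A.indicator (fun F => u F - v F) F * (u F + v F) := by
    rw [productMean, productMean, ← Finset.sum_sub_distrib]
    refine Finset.sum_congr rfl fun F _ => ?_
    by_cases hF : F ∈ A
    · simp only [Set.indicator_of_mem hF]
      ring
    · simp [Set.indicator_of_notMem hF]
  have hle : ∑ F ∈ T.powerset, A.indicator (fun F => u F - v F) F ^ 2 ≤ 2 - 2 * P := by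
    calc ∑ F ∈ T.powerset, A.indicator (fun F => u F - v F) F ^ 2
        ≤ ∑ F ∈ T.powerset, (u F ^ 2 + v F ^ 2 - 2 * (u F * v F)) := by
          refine Finset.sum_le_sum fun F _ => ?_
          by_cases hF : F ∈ A
          · rw [Set.indicator_of_mem hF]
            exact le_of_eq (by ring)
          · rw [Set.indicator_of_notMem hF]
            nlinarith [sq_nonneg (u F - v F)]
      _ = 2 - 2 * P := by
          rw [Finset.sum_sub_distrib, Finset.sum_add_distrib, ← Finset.mul_sum, hu, hv, huv]
          ring
  have hsum : ∑ F ∈ T.powerset, (u F + v F) ^ 2 = 2 + 2 * P := by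
    calc ∑ F ∈ T.powerset, (u F + v F) ^ 2
        = ∑ F ∈ T.powerset, (u F ^ 2 + v F ^ 2 + 2 * (u F * v F)) :=
          Finset.sum_congr rfl fun F _ => by ring
      _ = 2 + 2 * P := by
          rw [Finset.sum_add_distrib, Finset.sum_add_distrib, ← Finset.mul_sum, hu, hv, huv]
          ring
  have hpos : 0 ≤ 2 + 2 * P := hsum ▸ Finset.sum_nonneg fun F _ => sq_nonneg _
  calc (productMean T θ A - productMean T η A) ^ 2
      ≤ (∑ F ∈ T.powerset, A.indicator (fun F => u F - v F) F ^ 2) *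
          ∑ F ∈ T.powerset, (u F + v F) ^ 2 := by
        rw [hdiff]
        exact Finset.sum_mul_sq_le_sq_mul_sq _ _ _
    _ ≤ (2 - 2 * P) * (2 + 2 * P) := by
        rw [hsum]
        exact mul_le_mul_of_nonneg_right hle hpos
    _ ≤ 4 * ∑ x ∈ T, (θ x - η x) ^ 2 := by
        have := one_sub_sum_sq_le_prod_cos_sq T fun x => θ x - η x
        change _ ≤ P ^ 2 at this
        linarith [show (2 - 2 * P) * (2 + 2 * P) = 4 - 4 * P ^ 2 by ring]

theorem productMean_image_smul {G : Type*} [Group G] [MulAction G X] (g : G)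
    (T : Finset X) (θ : X → ℝ) (A : Set (Finset X)) :
    productMean T θ ((fun E : Finset X => Finset.image (g • ·) E) '' A) =
      productMean (T.image (g⁻¹ • ·)) (fun x => θ (g • x)) A := by
  have hinv : ∀ F : Finset X, (F.image (g⁻¹ • ·)).image (g • ·) = F := fun F => by
    simp [Finset.image_image, Function.comp_def]
  have hinv' : ∀ F : Finset X, (F.image (g • ·)).image (g⁻¹ • ·) = F := fun F => by
    simp [Finset.image_image, Function.comp_def]
  have hmem : ∀ F : Finset X, F ∈ (fun E : Finset X => Finset.image (g • ·) E) '' A ↔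
      F.image (g⁻¹ • ·) ∈ A := by
    intro F
    constructor
    · rintro ⟨E, hE, rfl⟩
      simpa only [hinv'] using hE
    · exact fun h => ⟨_, h, hinv F⟩
  have hamp : ∀ F : Finset X, productAmplitude T θ F =
      productAmplitude (T.image (g⁻¹ • ·)) (fun x => θ (g • x)) (F.image (g⁻¹ • ·)) := by
    intro F
    rw [productAmplitude, productAmplitude,
      Finset.prod_image (MulAction.injective g⁻¹).injOn]
    refine Finset.prod_congr rfl fun x _ => ?_
    simp
  refine Finset.sum_bij' (fun F _ => F.image (g⁻¹ • ·)) (fun F _ => F.image (g • ·))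
    ?_ ?_ (fun F _ => hinv F) (fun F _ => hinv' F) ?_
  · intro F hF
    exact Finset.mem_powerset.2 (Finset.image_subset_image (Finset.mem_powerset.1 hF))
  · intro F hF
    have := Finset.image_subset_image (f := (g • ·)) (Finset.mem_powerset.1 hF)
    rw [hinv] at this
    exact Finset.mem_powerset.2 this
  · intro F _
    by_cases hF : F.image (g⁻¹ • ·) ∈ A
    · rw [Set.indicator_of_mem ((hmem F).2 hF), Set.indicator_of_mem hF, hamp F]
    · rw [Set.indicator_of_notMem (fun h => hF ((hmem F).1 h)), Set.indicator_of_notMem hF]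

theorem mem_image_symmDiff (E F : Finset X) (A : Set (Finset X)) :
    F ∈ (fun F : Finset X => E ∆ F) '' A ↔ E ∆ F ∈ A := by
  constructor
  · rintro ⟨F', hF', rfl⟩
    simpa using hF'
  · exact fun h => ⟨_, h, symmDiff_symmDiff_cancel_left E F⟩

theorem productMean_image_symmDiff_singleton {T : Finset X} {θ : X → ℝ} {x₀ : X}
    (hx₀ : x₀ ∈ T) (hθ : Real.sin (θ x₀) = Real.cos (θ x₀)) (A : Set (Finset X)) :
    productMean T θ ((fun F : Finset X => {x₀} ∆ F) '' A) = productMean T θ A := by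
  have hamp : ∀ F : Finset X, productAmplitude T θ F = productAmplitude T θ ({x₀} ∆ F) := by
    intro F
    refine Finset.prod_congr rfl fun x _ => ?_
    by_cases hx : x = x₀
    · subst hx
      simp [hθ]
    · simp [Finset.mem_symmDiff, hx]
  have hpow : ∀ F ∈ T.powerset, {x₀} ∆ F ∈ T.powerset := by
    intro F hF
    rw [Finset.mem_powerset] at hF ⊢
    exact symmDiff_le_sup.trans (sup_le (Finset.singleton_subset_iff.2 hx₀) hF)
  refine Finset.sum_bij' (fun F _ => {x₀} ∆ F) (fun F _ => {x₀} ∆ F) hpow hpow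
    (fun F _ => symmDiff_symmDiff_cancel_left _ F)
    (fun F _ => symmDiff_symmDiff_cancel_left _ F) ?_
  intro F _
  by_cases hF : {x₀} ∆ F ∈ A
  · rw [Set.indicator_of_mem ((mem_image_symmDiff _ F A).2 hF), Set.indicator_of_mem hF, hamp F]
  · rw [Set.indicator_of_notMem (fun h => hF ((mem_image_symmDiff _ F A).1 h)),
      Set.indicator_of_notMem hF]

end ProductMean

theorem sum_sq_sub_le_schreierEnergy {G X : Type*} [Group G] [MulAction G X]
    {S : Finset G} {g : G} (hg : g ∈ S) (a : X →₀ ℝ) (T : Finset X) :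
    ∑ x ∈ T, (a x - a (g • x)) ^ 2 ≤ schreierEnergy S a := by
  classical
  set U : Finset X := T ∪ (a.support ∪ S.biUnion fun s => a.support.image (s⁻¹ • ·))
  have hsupp : Function.support (fun x => ∑ s ∈ S, (a x - a (s • x)) ^ 2) ⊆ U := by
    intro x hx
    by_contra hxU
    refine hx (Finset.sum_eq_zero fun s hs => ?_)
    have hx0 : a x = 0 := by
      by_contra h
      exact hxU (by simp [U, h])
    have hsx0 : a (s • x) = 0 := by
      by_contra h
      refine hxU (Finset.mem_union_right _ (Finset.mem_union_right _ ?_))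
      exact Finset.mem_biUnion.2 ⟨s, hs, Finset.mem_image.2
        ⟨s • x, Finsupp.mem_support_iff.2 h, inv_smul_smul s x⟩⟩
    simp [hx0, hsx0]
  rw [schreierEnergy, finsum_eq_sum_of_support_subset _ hsupp]
  calc ∑ x ∈ T, (a x - a (g • x)) ^ 2
      ≤ ∑ x ∈ U, (a x - a (g • x)) ^ 2 :=
        Finset.sum_le_sum_of_subset_of_nonneg Finset.subset_union_left
          fun x _ _ => sq_nonneg _
    _ ≤ ∑ x ∈ U, ∑ s ∈ S, (a x - a (s • x)) ^ 2 :=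
        Finset.sum_le_sum fun x _ =>
          Finset.single_le_sum (f := fun s => (a x - a (s • x)) ^ 2)
            (fun s _ => sq_nonneg _) hg

theorem sq_productMean_image_smul_sub_le {G X : Type*} [Group G] [MulAction G X]
    [DecidableEq X] {S : Finset G} {g : G} (hg : g ∈ S) (a : X →₀ ℝ) (c : ℝ)
    (A : Set (Finset X)) :
    (productMean a.support (fun x => c * a x)
        ((fun E : Finset X => Finset.image (g • ·) E) '' A) -
      productMean a.support (fun x => c * a x) A) ^ 2 ≤ 4 * (c ^ 2 * schreierEnergy S a) := by
  set T := a.support ∪ a.support.image (g⁻¹ • ·)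
  rw [productMean_image_smul,
    productMean_eq_of_subset (T' := T) Finset.subset_union_right,
    productMean_eq_of_subset (T := a.support) (T' := T) Finset.subset_union_left]
  · refine (sq_productMean_sub_le T _ _ A).trans ?_
    have h := mul_le_mul_of_nonneg_left (sum_sq_sub_le_schreierEnergy hg a T) (sq_nonneg c)
    rw [Finset.mul_sum] at h
    refine mul_le_mul_of_nonneg_left (le_trans (le_of_eq ?_) h) (by norm_num)
    exact Finset.sum_congr rfl fun x _ => by ring
  · intro x hx
    simp [Finsupp.notMem_support_iff.1 hx]
  · intro x hx
    have : a (g • x) = 0 := by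
      by_contra h
      exact hx (Finset.mem_image.2
        ⟨g • x, Finsupp.mem_support_iff.2 h, inv_smul_smul g x⟩)
    simp [this]

theorem IsMean.exists_tendsto_ultrafilter {ι X : Type*} (u : Ultrafilter ι)
    {m : ι → Set X → ℝ} (hm : ∀ i, IsMean (m i)) :
    ∃ μ : Set X → ℝ, IsMean μ ∧
      ∀ A, Filter.Tendsto (fun i => m i A) u (nhds (μ A)) := by
  have hlim : ∀ A, ∃ r ∈ Set.Icc (0 : ℝ) 1,
      Filter.Tendsto (fun i => m i A) u (nhds r) := fun A =>
    isCompact_Icc.ultrafilter_le_nhds (u.map fun i => m i A)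
      (Filter.le_principal_iff.2 (Filter.mem_map.2 (Filter.univ_mem' fun i =>
        ⟨(hm i).nonneg A, (hm i).le_one A⟩)))
  choose μ hμ hlim using hlim
  refine ⟨μ, ⟨fun A => (hμ A).1, fun A => (hμ A).2, ?_, fun A B hAB => ?_⟩, hlim⟩
  · refine tendsto_nhds_unique (hlim Set.univ) ?_
    simp [(hm _).total]
  · refine tendsto_nhds_unique (hlim (A ∪ B)) ?_
    simpa only [(hm _).additive A B hAB] using (hlim A).add (hlim B)

/-- A function on families of finite sets that is invariant under a transitive group and under
the translation by one singleton is invariant under all translations. -/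
theorem image_symmDiff_invariant_of_singleton {G X : Type*} [Group G] [MulAction G X]
    [MulAction.IsPretransitive G X] [DecidableEq X] {μ : Set (Finset X) → ℝ} {x₀ : X}
    (hG : ∀ (g : G) (A : Set (Finset X)),
      μ ((fun E : Finset X => Finset.image (g • ·) E) '' A) = μ A)
    (hx₀ : ∀ A : Set (Finset X), μ ((fun F : Finset X => {x₀} ∆ F) '' A) = μ A)
    (E : Finset X) (A : Set (Finset X)) :
    μ ((fun F : Finset X => E ∆ F) '' A) = μ A := by
  induction E using Finset.induction_on generalizing A with
  | empty =>
    have h : (fun F : Finset X => (∅ : Finset X) ∆ F) = id := funext fun F => bot_symmDiff F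
    rw [h, Set.image_id]
  | insert y E hy ih =>
    obtain ⟨g, rfl⟩ := MulAction.exists_smul_eq G x₀ y
    have hins : insert (g • x₀) E = {g • x₀} ∆ E := by
      ext z
      by_cases hz : z = g • x₀
      · subst hz
        simp [Finset.mem_symmDiff, hy]
      · simp [Finset.mem_symmDiff, hz]
    have hconj : ∀ F : Finset X, ({g • x₀} : Finset X) ∆ F =
        Finset.image (g • ·) ({x₀} ∆ Finset.image (g⁻¹ • ·) F) := by
      intro F
      rw [Finset.image_symmDiff _ _ (MulAction.injective g)]
      simp [Finset.image_image, Function.comp_def]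
    have hcomp : (fun F : Finset X => insert (g • x₀) E ∆ F) =
        (fun F : Finset X => Finset.image (g • ·) F) ∘ (fun F : Finset X => {x₀} ∆ F) ∘
          (fun F : Finset X => Finset.image (g⁻¹ • ·) F) ∘ (fun F : Finset X => E ∆ F) := by
      funext F
      simp only [Function.comp_apply, ← hconj]
      rw [hins, symmDiff_assoc]
    rw [hcomp, Set.image_comp, hG, Set.image_comp, hx₀, Set.image_comp, hG, ih]

theorem image_smul_invariant_of_closure_eq_top {G X : Type*} [Group G] [MulAction G X]
    [DecidableEq X] {μ : Set (Finset X) → ℝ} {S : Set G} (hS : Subgroup.closure S = ⊤)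
    (h : ∀ g ∈ S, ∀ A : Set (Finset X),
      μ ((fun E : Finset X => Finset.image (g • ·) E) '' A) = μ A)
    (g : G) (A : Set (Finset X)) :
    μ ((fun E : Finset X => Finset.image (g • ·) E) '' A) = μ A := by
  have hg : g ∈ Subgroup.closure S := hS ▸ Subgroup.mem_top g
  have hmul : ∀ g k : G, ∀ A : Set (Finset X),
      (fun E : Finset X => Finset.image ((g * k) • ·) E) '' A =
        (fun E : Finset X => Finset.image (g • ·) E) ''
          ((fun E : Finset X => Finset.image (k • ·) E) '' A) := by
    intro g k A
    simp only [Set.image_image, Finset.image_image, Function.comp_def, mul_smul]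
  have hone : ∀ A : Set (Finset X),
      (fun E : Finset X => Finset.image ((1 : G) • ·) E) '' A = A := by
    intro A
    simp
  induction hg using Subgroup.closure_induction generalizing A with
  | mem g hg => exact h g hg A
  | one => rw [hone]
  | mul g k _ _ ihg ihk => rw [hmul, ihg, ihk]
  | inv g _ ih => rw [← ih, ← hmul, mul_inv_cancel, hone]

/-- **Theorem 1.2 / Lemma 3.1 + Theorem 3.4.** Let `G` be a finitely generated group
acting transitively on a set `X`, with finite symmetric generating set `S`. If the
Schreier graph of the action of `G` on `X` is recurrent, then there exists a mean on
the group `𝒫_f(X) = ⊕_X ℤ/2ℤ` of finite subsets of `X` (with symmetric difference as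
the group operation, finite subsets being modelled by `Finset X`) which is invariant
under the restricted wreath product `(ℤ/2ℤ) ≀_X G`.  Invariance under the wreath
product, whose action is generated by the transformations `F ↦ g • F` (`g ∈ G`) and
`F ↦ E ∆ F` (`E ∈ 𝒫_f(X)`), is expressed as invariance under these generating
transformations. -/
theorem stmt1 {G X : Type*} [Group G] [MulAction G X] [MulAction.IsPretransitive G X]
    [DecidableEq X]
    (S : Finset G) (hS : IsSymmGen S)
    (x₀ : X) (hrec : SchreierRecurrentAt G S x₀) :
    ∃ μ : Set (Finset X) → ℝ, IsMean μ ∧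
      (∀ (g : G) (A : Set (Finset X)),
        μ ((fun E : Finset X => Finset.image (g • ·) E) '' A) = μ A) ∧
      (∀ (E : Finset X) (A : Set (Finset X)),
        μ ((fun F : Finset X => E ∆ F) '' A) = μ A) := by
  choose a _ ha₁ hae using fun n : ℕ => hrec (1 / ((n : ℝ) + 1)) Nat.one_div_pos_of_nat
  set m : ℕ → Set (Finset X) → ℝ := fun n =>
    productMean (a n).support fun x => Real.pi / 4 * a n x
  obtain ⟨μ, hμ, hlim⟩ := IsMean.exists_tendsto_ultrafilter (Filter.hyperfilter ℕ)
    (m := m) fun n => isMean_productMean _ _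
  have hG : ∀ (g : G) (A : Set (Finset X)),
      μ ((fun E : Finset X => Finset.image (g • ·) E) '' A) = μ A := by
    refine image_smul_invariant_of_closure_eq_top hS.2 fun g hg A => ?_
    have hsq : Filter.Tendsto
        (fun n => (m n ((fun E : Finset X => Finset.image (g • ·) E) '' A) - m n A) ^ 2)
        Filter.atTop (nhds 0) := by
      have hbound : Filter.Tendsto
          (fun n : ℕ => 4 * ((Real.pi / 4) ^ 2 * (1 / ((n : ℝ) + 1)))) Filter.atTop
          (nhds 0) := by
        simpa only [mul_zero] using ((tendsto_one_div_add_atTop_nhds_zero_nat (𝕜 := ℝ)).const_mul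
          ((Real.pi / 4) ^ 2)).const_mul 4
      refine squeeze_zero (fun n => sq_nonneg _) (fun n => ?_) hbound
      refine (sq_productMean_image_smul_sub_le hg (a n) (Real.pi / 4) A).trans ?_
      have := (hae n).le
      gcongr
    have hle : (Filter.hyperfilter ℕ : Filter ℕ) ≤ Filter.atTop := Nat.hyperfilter_le_atTop
    have := tendsto_nhds_unique (((hlim _).sub (hlim A)).pow 2) (hsq.mono_left hle)
    exact sub_eq_zero.1 (pow_eq_zero_iff two_ne_zero |>.1 this)
  refine ⟨μ, hμ, hG, image_symmDiff_invariant_of_singleton hG (x₀ := x₀) fun A => ?_⟩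
  refine tendsto_nhds_unique (hlim _) ((hlim A).congr fun n => ?_)
  refine (productMean_image_symmDiff_singleton ?_ ?_ A).symm
  · simp [ha₁ n]
  · simp [ha₁ n]
end

section
/- Let G be a discrete group acting on a set X. The following are equivalent: (1) the action of G on X is amenable, i.e., admits an invariant mean; (2) Reiter's condition: for every finite subset S ⊆ G and every ε > 0 there exists a non-negative function φ ∈ ℓ¹(X) with ‖φ‖₁ = 1 and ‖g·φ − φ‖₁ < ε for all g ∈ S; (3) Følner's condition: for every finite subset S ⊆ G and every ε > 0 there exists a finite subset F ⊆ X with Σ_{g∈S} |gF Δ F| < ε|F|. -/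
open scoped symmDiff

/-- Reiter's condition for the action of `G` on `X`: for every finite `S ⊆ G` and
`ε > 0` there is a non-negative `φ ∈ ℓ¹(X)` with `‖φ‖₁ = 1` and `‖g·φ - φ‖₁ < ε` for
all `g ∈ S`, where `(g·φ)(x) = φ(g⁻¹ • x)`. -/
def ReiterCondition (G X : Type*) [Group G] [MulAction G X] : Prop :=
  ∀ (S : Finset G) (ε : ℝ), 0 < ε → ∃ φ : X → ℝ,
    (∀ x, 0 ≤ φ x) ∧ HasSum φ 1 ∧
      ∀ g ∈ S, (∑' x : X, |φ (g⁻¹ • x) - φ x|) < ε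

/-- Følner's condition for the action of `G` on `X`: for every finite `S ⊆ G` and
`ε > 0` there is a finite `F ⊆ X` with `∑_{g ∈ S} |gF Δ F| < ε·|F|`. -/
def FolnerCondition (G X : Type*) [Group G] [MulAction G X] [DecidableEq X] : Prop :=
  ∀ (S : Finset G) (ε : ℝ), 0 < ε → ∃ F : Finset X,
    (∑ g ∈ S, ((Finset.image (g • ·) F ∆ F).card : ℝ)) < ε * F.card

theorem IsMean.apply_empty {X : Type*} {μ : Set X → ℝ} (hμ : IsMean μ) : μ ∅ = 0 := by
  have h := hμ.additive ∅ ∅ (by simp)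
  rw [Set.union_empty] at h
  linarith

theorem IsMean.apply_preimage_finset {X J : Type*} {μ : Set X → ℝ} (hμ : IsMean μ)
    (h : X → J) (T : Finset J) : μ (h ⁻¹' T) = ∑ a ∈ T, μ (h ⁻¹' {a}) := by
  classical
  induction T using Finset.induction_on with
  | empty => simp [hμ.apply_empty]
  | insert a T ha ih =>
    rw [Finset.sum_insert ha, ← ih, ← hμ.additive]
    · congr 1
      ext x
      simp
    · rw [Set.disjoint_left]
      rintro x hx hx'
      simp only [Set.mem_preimage, Set.mem_singleton_iff] at hx
      simp only [Set.mem_preimage, hx] at hx'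
      exact ha hx'

open Classical in
/-- A mean is monotone on linear combinations of indicator functions. -/
theorem IsMean.le_sum_mul {X ι : Type*} {μ : Set X → ℝ} (hμ : IsMean μ) (s : Finset ι)
    (c : ι → ℝ) (A : ι → Set X) (r : ℝ)
    (hr : ∀ x, r ≤ ∑ i ∈ s, c i * (if x ∈ A i then 1 else 0)) :
    r ≤ ∑ i ∈ s, c i * μ (A i) := by
  set h : X → Finset ι := fun x => s.filter (fun i => x ∈ A i) with hh
  have hA : ∀ i ∈ s, μ (A i) = ∑ a ∈ s.powerset, if i ∈ a then μ (h ⁻¹' {a}) else 0 := by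
    intro i hi
    rw [← Finset.sum_filter, ← hμ.apply_preimage_finset]
    congr 1
    ext x
    simp [hh, hi]
  have h1 : ∑ a ∈ s.powerset, μ (h ⁻¹' {a}) = 1 := by
    rw [← hμ.apply_preimage_finset, ← hμ.total]
    congr 1
    exact Set.eq_univ_of_forall fun x => Finset.mem_powerset.2 (Finset.filter_subset _ _)
  calc r = ∑ a ∈ s.powerset, r * μ (h ⁻¹' {a}) := by rw [← Finset.mul_sum, h1, mul_one]
    _ ≤ ∑ a ∈ s.powerset, (∑ i ∈ s, c i * (if i ∈ a then 1 else 0)) * μ (h ⁻¹' {a}) := by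
      refine Finset.sum_le_sum fun a _ => ?_
      by_cases hne : (h ⁻¹' {a}).Nonempty
      · obtain ⟨x, hx⟩ := hne
        refine mul_le_mul_of_nonneg_right ((hr x).trans_eq ?_) (hμ.nonneg _)
        refine Finset.sum_congr rfl fun i hi => ?_
        have hx' : h x = a := hx
        simp [← hx', hh, hi]
      · rw [Set.not_nonempty_iff_eq_empty.1 hne, hμ.apply_empty]
        simp
    _ = ∑ i ∈ s, c i * μ (A i) := by
      simp_rw [Finset.sum_mul]
      rw [Finset.sum_comm]
      refine Finset.sum_congr rfl fun i hi => ?_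
      rw [hA i hi, Finset.mul_sum]
      refine Finset.sum_congr rfl fun a _ => ?_
      split_ifs <;> simp

theorem IsInvariantMean.apply_preimage_smul {G X : Type*} [Group G] [MulAction G X]
    {μ : Set X → ℝ} (hμ : IsInvariantMean G μ) (g : G) (A : Set X) :
    μ ((g • ·) ⁻¹' A) = μ A := by
  rw [← hμ.2 g ((g • ·) ⁻¹' A), Set.image_preimage_eq _ (MulAction.surjective g)]

open Classical in
/-- A finite sum of coboundaries of bounded functions is not bounded below by a positive
constant when there is an invariant mean. -/
theorem IsInvariantMean.not_forall_lt_sum_sub {G X : Type*} [Group G] [MulAction G X]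
    {μ : Set X → ℝ} (hμ : IsInvariantMean G μ) (S : Finset G) (f : G → X → ℝ) {C u : ℝ}
    (hf : ∀ g x, |f g x| ≤ C) (hu : 0 < u) :
    ¬ ∀ x, u ≤ ∑ g ∈ S, (f g (g • x) - f g x) := by
  intro H
  obtain ⟨N, hN⟩ := exists_nat_gt ((S.card : ℝ) / u)
  rw [div_lt_iff₀ hu] at hN
  set n : G → X → ℕ := fun g x => ⌊N * (f g x + C)⌋₊ with hn
  have hpos : ∀ g x, 0 ≤ N * (f g x + C) := fun g x =>
    mul_nonneg N.cast_nonneg (by linarith [(abs_le.1 (hf g x)).1])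
  set M : ℕ := ⌊N * (C + C)⌋₊
  have hnM : ∀ g x, n g x ≤ M := fun g x => Nat.floor_le_floor
    (mul_le_mul_of_nonneg_left (by linarith [(abs_le.1 (hf g x)).2]) N.cast_nonneg)
  have hlayer : ∀ g x, (n g x : ℝ) = ∑ k ∈ Finset.range M, if k < n g x then (1 : ℝ) else 0 := by
    intro g x
    rw [Finset.sum_boole]
    congr 1
    rw [show (Finset.range M).filter (· < n g x) = Finset.range (n g x) by
      ext k
      have := hnM g x
      simp only [Finset.mem_filter, Finset.mem_range]
      omega]
    simp
  have hlow : ∀ x, N * u - S.card ≤ ∑ g ∈ S, ((n g (g • x) : ℝ) - n g x) := by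
    intro x
    calc N * u - S.card ≤ N * (∑ g ∈ S, (f g (g • x) - f g x)) - S.card := by
          gcongr
          exact H x
      _ = ∑ g ∈ S, (N * (f g (g • x) - f g x) - 1) := by
          rw [Finset.mul_sum, Finset.sum_sub_distrib _ fun _ => (1 : ℝ)]
          simp
      _ ≤ _ := by
          refine Finset.sum_le_sum fun g _ => ?_
          have h1 := Nat.lt_floor_add_one (N * (f g (g • x) + C))
          have h2 := Nat.floor_le (hpos g x)
          simp only [hn]
          linarith
  have key := hμ.1.le_sum_mul ((S ×ˢ Finset.range M) ×ˢ (Finset.univ : Finset Bool))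
    (fun i => if i.2 then 1 else -1)
    (fun i => if i.2 then (i.1.1 • ·) ⁻¹' {x | i.1.2 < n i.1.1 x} else {x | i.1.2 < n i.1.1 x})
    (N * u - S.card) (fun x => (hlow x).trans_eq (by
      simp only [Finset.sum_product, Fintype.sum_bool]
      refine Finset.sum_congr rfl fun g _ => ?_
      rw [hlayer g (g • x), hlayer g x, ← Finset.sum_sub_distrib]
      refine Finset.sum_congr rfl fun k _ => ?_
      simp only [if_true, Set.mem_preimage, Set.mem_ofPred_eq, Bool.false_eq_true, if_false]
      ring))
  simp only [Finset.sum_product, Fintype.sum_bool] at key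
  simp only [if_true, hμ.apply_preimage_smul] at key
  simp at key
  linarith

theorem Summable.abs_translate_sub {G X : Type*} [Group G] [MulAction G X] {φ : X → ℝ}
    (hφ : Summable φ) (g : G) : Summable fun x => |φ (g⁻¹ • x) - φ x| :=
  (((MulAction.toPerm g⁻¹).summable_iff.2 hφ).sub hφ).abs

open Classical in
theorem AmenableAction.reiterCondition {G X : Type*} [Group G] [MulAction G X]
    (h : AmenableAction G X) : ReiterCondition G X := by
  obtain ⟨μ, hμ⟩ := h
  intro S ε hε
  let δ : G × X → lp (fun _ : G × X => ℝ) 1 := fun p => lp.single 1 p 1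
  let v : X → lp (fun _ : G × X => ℝ) 1 := fun x => ∑ g ∈ S, (δ (g, g • x) - δ (g, x))
  let K := convexHull ℝ (Set.range v)
  have hK : ∀ k ∈ K, ∃ φ : X → ℝ, (∀ x, 0 ≤ φ x) ∧ HasSum φ 1 ∧
      ∀ g ∈ S, ∀ x, (k : G × X → ℝ) (g, x) = φ (g⁻¹ • x) - φ x := by
    apply convexHull_min (t := {k : lp (fun _ : G × X => ℝ) 1 | ∃ φ : X → ℝ, (∀ x, 0 ≤ φ x) ∧
      HasSum φ 1 ∧ ∀ g ∈ S, ∀ x, (k : G × X → ℝ) (g, x) = φ (g⁻¹ • x) - φ x})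
    · rintro _ ⟨y, rfl⟩
      refine ⟨Pi.single y 1, fun x => ?_, hasSum_pi_single y 1, fun g hg x => ?_⟩
      · by_cases hxy : x = y
        · subst hxy; simp
        · simp [hxy]
      · simp only [v, δ, lp.coeFn_sum, lp.coeFn_sub, Finset.sum_apply, Pi.sub_apply,
          lp.single_apply, Pi.single_apply, Prod.mk.injEq]
        rw [Finset.sum_eq_single g]
        · simp [inv_smul_eq_iff]
        · intro b _ hb
          simp [hb.symm]
        · exact fun h => absurd hg h
    · rintro k ⟨φ, hφ0, hφ1, hφ⟩ l ⟨ψ, hψ0, hψ1, hψ⟩ a b ha hb hab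
      refine ⟨fun x => a * φ x + b * ψ x, fun x => ?_, ?_, fun g hg x => ?_⟩
      · have := hφ0 x
        have := hψ0 x
        positivity
      · simpa [hab] using (hφ1.mul_left a).add (hψ1.mul_left b)
      · simp only [lp.coeFn_add, lp.coeFn_smul, Pi.add_apply, Pi.smul_apply, smul_eq_mul,
          hφ g hg x, hψ g hg x]
        ring
  have h0 : (0 : lp (fun _ : G × X => ℝ) 1) ∈ closure K := by
    by_contra h0
    obtain ⟨L, u, hLu, hL⟩ := geometric_hahn_banach_point_closed
      (convex_convexHull ℝ (Set.range v)).closure isClosed_closure h0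
    rw [map_zero] at hLu
    refine hμ.not_forall_lt_sum_sub S (fun g x => L (δ (g, x))) (C := ‖L‖) (fun g x => ?_) hLu
      (fun x => ?_)
    · have := L.le_opNorm (δ (g, x))
      simpa [δ, lp.norm_single] using this
    · have := hL (v x) (subset_closure (subset_convexHull ℝ _ ⟨x, rfl⟩))
      simpa [v] using this.le
  obtain ⟨k, hk, hkε⟩ := Metric.mem_closure_iff.1 h0 ε hε
  rw [dist_zero_left] at hkε
  obtain ⟨φ, hφ0, hφ1, hφ⟩ := hK k hk
  refine ⟨φ, hφ0, hφ1, fun g hg => lt_of_le_of_lt ?_ hkε⟩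
  have hs : HasSum (fun p => |(k : G × X → ℝ) p|) ‖k‖ := by
    simpa using lp.hasSum_norm (p := 1) (by simp) k
  rw [← hs.tsum_eq]
  refine (hφ1.summable.abs_translate_sub g).tsum_le_tsum_of_inj (fun x => (g, x))
    (Prod.mk_right_injective g) (fun _ _ => abs_nonneg _) (fun x => ?_) hs.summable
  rw [hφ g hg x]

theorem ReiterCondition.amenableAction {G X : Type*} [Group G] [MulAction G X]
    (h : ReiterCondition G X) : AmenableAction G X := by
  classical
  choose φ hφ0 hφ1 hφ using fun i : Finset G × ℕ =>
    h i.1 (1 / ((i.2 : ℝ) + 1)) Nat.one_div_pos_of_nat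
  let m : Finset G × ℕ → Set X → ℝ := fun i A => ∑' x, A.indicator (φ i) x
  have hsum : ∀ i (A : Set X), Summable (A.indicator (φ i)) := fun i A =>
    (hφ1 i).summable.indicator A
  have hm0 : ∀ i A, 0 ≤ m i A := fun i A =>
    tsum_nonneg fun x => Set.indicator_nonneg (fun x _ => hφ0 i x) x
  have hm1 : ∀ i A, m i A ≤ 1 := fun i A => by
    rw [← (hφ1 i).tsum_eq]
    exact (hsum i A).tsum_le_tsum (fun x => Set.indicator_le_self' (fun _ _ => hφ0 i _) x)
      (hφ1 i).summable
  let U : Ultrafilter (Finset G × ℕ) := Ultrafilter.of Filter.atTop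
  have hlim : ∀ A, ∃ l, Filter.Tendsto (fun i => m i A) U (nhds l) := fun A => by
    obtain ⟨l, -, hl⟩ := (isCompact_Icc (a := (0 : ℝ)) (b := 1)).ultrafilter_le_nhds
      (U.map fun i => m i A) (by
        simp only [Ultrafilter.coe_map, Filter.le_principal_iff, Filter.mem_map]
        exact Filter.univ_mem' fun i => ⟨hm0 i A, hm1 i A⟩)
    exact ⟨l, hl⟩
  choose μ hμ using hlim
  refine ⟨μ, ⟨fun A => ge_of_tendsto' (hμ A) fun i => hm0 i A,
    fun A => le_of_tendsto' (hμ A) fun i => hm1 i A, ?_, fun A B hAB => ?_⟩, fun g A => ?_⟩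
  · refine tendsto_nhds_unique (hμ _) (tendsto_const_nhds.congr fun i => ?_)
    simp [m, (hφ1 i).tsum_eq]
  · refine tendsto_nhds_unique (hμ _) (((hμ A).add (hμ B)).congr fun i => ?_)
    simp only [m]
    rw [← (hsum i A).tsum_add (hsum i B), Set.indicator_union_of_disjoint hAB]
  · have hU : (U : Filter (Finset G × ℕ)) ≤ Filter.atTop := Ultrafilter.of_le _
    have hdiff : Filter.Tendsto (fun i => m i ((g • ·) '' A) - m i A) U (nhds 0) := by
      have hbound : Filter.Tendsto (fun i : Finset G × ℕ => 1 / ((i.2 : ℝ) + 1)) U (nhds 0) := by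
        refine (tendsto_one_div_add_atTop_nhds_zero_nat (𝕜 := ℝ)).comp
          (Filter.Tendsto.mono_left ?_ hU)
        rw [← Filter.prod_atTop_atTop_eq]
        exact Filter.tendsto_snd
      refine squeeze_zero_norm' ?_ hbound
      filter_upwards [hU (Filter.eventually_ge_atTop (({g⁻¹} : Finset G), 0))] with i hi
      have hg : g⁻¹ ∈ i.1 := hi.1 (Finset.mem_singleton_self _)
      have hshift : m i ((g • ·) '' A) = ∑' x, A.indicator (fun x => φ i (g • x)) x := by
        simp only [m]
        rw [← (MulAction.toPerm g).tsum_eq]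
        refine tsum_congr fun x => ?_
        simp [Set.indicator_apply]
      have hs' : Summable fun x => φ i (g • x) :=
        (MulAction.toPerm g).summable_iff.2 (hφ1 i).summable
      have hs := (hφ1 i).summable.abs_translate_sub g⁻¹
      rw [hshift, ← (hs'.indicator A).tsum_sub (hsum i A)]
      refine le_trans ?_ (hφ i g⁻¹ hg).le
      refine tsum_of_norm_bounded hs.hasSum fun x => ?_
      by_cases hx : x ∈ A
      · simp [hx]
      · simp [hx]
    have := tendsto_nhds_unique hdiff ((hμ _).sub (hμ A))
    linarith

theorem Finset.hasSum_ite_mem {X : Type*} [DecidableEq X] (F : Finset X) :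
    HasSum (fun x => if x ∈ F then (1 : ℝ) else 0) F.card := by
  have h : HasSum (fun x => if x ∈ F then (1 : ℝ) else 0)
      (∑ x ∈ F, if x ∈ F then (1 : ℝ) else 0) :=
    hasSum_sum_of_ne_finset_zero fun x hx => if_neg hx
  simpa using h

theorem hasSum_abs_indicator_sub {G X : Type*} [Group G] [MulAction G X] [DecidableEq X]
    (F : Finset X) (g : G) :
    HasSum (fun x => |(if g⁻¹ • x ∈ F then (1 : ℝ) else 0) - if x ∈ F then 1 else 0|)
      ((Finset.image (g • ·) F ∆ F).card : ℝ) := by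
  have hmem : ∀ x, x ∈ Finset.image (g • ·) F ↔ g⁻¹ • x ∈ F := fun x => by
    simp only [Finset.mem_image]
    exact ⟨by rintro ⟨y, hy, rfl⟩; simpa using hy, fun h => ⟨_, h, by simp⟩⟩
  have : (fun x => |(if g⁻¹ • x ∈ F then (1 : ℝ) else 0) - if x ∈ F then 1 else 0|) =
      fun x => if x ∈ Finset.image (g • ·) F ∆ F then 1 else 0 := by
    funext x
    simp only [Finset.mem_symmDiff, hmem]
    by_cases h1 : g⁻¹ • x ∈ F <;> by_cases h2 : x ∈ F <;> simp [h1, h2]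
  rw [this]
  exact Finset.hasSum_ite_mem _

theorem FolnerCondition.reiterCondition {G X : Type*} [Group G] [MulAction G X] [DecidableEq X]
    (h : FolnerCondition G X) : ReiterCondition G X := by
  intro S ε hε
  obtain ⟨F, hF⟩ := h S ε hε
  have hF0 : (0 : ℝ) < F.card :=
    pos_of_mul_pos_right ((Finset.sum_nonneg fun _ _ => Nat.cast_nonneg _).trans_lt hF) hε.le
  refine ⟨fun x => (F.card : ℝ)⁻¹ * if x ∈ F then 1 else 0, fun x => ?_, ?_, fun g hg => ?_⟩
  · positivity
  · simpa [hF0.ne'] using F.hasSum_ite_mem.mul_left (F.card : ℝ)⁻¹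
  · simp_rw [← mul_sub, abs_mul, abs_of_pos (inv_pos.2 hF0)]
    rw [((hasSum_abs_indicator_sub F g).mul_left _).tsum_eq, inv_mul_lt_iff₀ hF0, mul_comm]
    refine lt_of_le_of_lt ?_ hF
    exact Finset.single_le_sum (f := fun g : G => ((Finset.image (g • ·) F ∆ F).card : ℝ))
      (fun _ _ => Nat.cast_nonneg _) hg

/-- An isoperimetric inequality for finite sets extends to finitely supported non-negative
functions. -/
theorem mul_sum_le_of_forall_mul_card_le {G X : Type*} [Group G] [MulAction G X] [DecidableEq X]
    {S : Finset G} {ε : ℝ}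
    (H : ∀ F : Finset X, ε * F.card ≤ ∑ g ∈ S, ((Finset.image (g • ·) F ∆ F).card : ℝ))
    (F : Finset X) : ∀ ψ : X → ℝ, (∀ x, 0 ≤ ψ x) → (∀ x ∉ F, ψ x = 0) →
      ε * ∑ x ∈ F, ψ x ≤ ∑ g ∈ S, ∑' x, |ψ (g⁻¹ • x) - ψ x| := by
  induction F using Finset.strongInduction with
  | H F ih =>
    intro ψ hψ0 hψF
    rcases F.eq_empty_or_nonempty with rfl | hne
    · simpa using Finset.sum_nonneg fun g _ => tsum_nonneg fun x => abs_nonneg _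
    obtain ⟨x₀, hx₀, hmin⟩ := F.exists_min_image ψ hne
    set c := ψ x₀ with hc
    let ψ' : X → ℝ := fun x => ψ x - c * if x ∈ F then 1 else 0
    have hψ'0 : ∀ x, 0 ≤ ψ' x := fun x => by
      by_cases hx : x ∈ F
      · simpa [ψ', hx] using hmin x hx
      · simpa [ψ', hx] using hψ0 x
    have hψ'F : ∀ x ∉ F, ψ' x = 0 := fun x hx => by simp [ψ', hx, hψF x hx]
    have hψ'E : ∀ x ∉ F.erase x₀, ψ' x = 0 := fun x hx => by
      by_cases hxF : x ∈ F
      · have : x = x₀ := by simpa [hxF] using hx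
        simp [ψ', this, hx₀, hc]
      · exact hψ'F x hxF
    have hih := ih _ (Finset.erase_ssubset hx₀) ψ' hψ'0 hψ'E
    have hsum : ∑ x ∈ F, ψ x = c * F.card + ∑ x ∈ F.erase x₀, ψ' x := by
      rw [Finset.sum_subset (Finset.erase_subset x₀ F) fun x _ hx => hψ'E x hx]
      simp [ψ', mul_comm]
    have hterm : ∀ g : G, ∑' x, |ψ (g⁻¹ • x) - ψ x| =
        c * ((Finset.image (g • ·) F ∆ F).card : ℝ) + ∑' x, |ψ' (g⁻¹ • x) - ψ' x| := by
      intro g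
      have hF := (hasSum_abs_indicator_sub F g).mul_left c
      rw [← hF.tsum_eq, ← hF.summable.tsum_add
        ((summable_of_ne_finset_zero hψ'F).abs_translate_sub g)]
      refine tsum_congr fun x => ?_
      have hpair : ∀ y z, |ψ y - ψ z| =
          c * |(if y ∈ F then (1 : ℝ) else 0) - if z ∈ F then 1 else 0| + |ψ' y - ψ' z| := by
        intro y z
        have hc0 : 0 ≤ c := hψ0 x₀
        by_cases hy : y ∈ F <;> by_cases hz : z ∈ F
        · simp [ψ', hy, hz]
        · have h1 := hmin y hy
          simp [ψ', hy, hz, hψF z hz, abs_of_nonneg, hψ0 y, h1]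
        · have h1 := hmin z hz
          simp [ψ', hy, hz, hψF y hy, abs_of_nonneg, hψ0 z, abs_sub_comm c, h1]
        · simp [ψ', hy, hz]
      exact hpair _ _
    simp_rw [hterm]
    rw [Finset.sum_add_distrib, ← Finset.mul_sum, hsum]
    have := mul_le_mul_of_nonneg_left (H F) (hψ0 x₀)
    rw [← hc] at this
    linarith

theorem ReiterCondition.folnerCondition {G X : Type*} [Group G] [MulAction G X] [DecidableEq X]
    (h : ReiterCondition G X) : FolnerCondition G X := by
  intro S ε hε
  by_contra! H
  have hD : (0 : ℝ) < 3 * S.card + ε + 1 := by positivity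
  set η : ℝ := ε / (3 * S.card + ε + 1) with hη
  have hη0 : 0 < η := div_pos hε hD
  have hηD : η * (3 * S.card + ε + 1) = ε := div_mul_cancel₀ _ hD.ne'
  obtain ⟨φ, hφ0, hφ1, hφ⟩ := h S η hη0
  obtain ⟨T, hT⟩ := (hφ1.eventually_const_lt (show 1 - η < 1 by linarith)).exists
  let ψ : X → ℝ := fun x => if x ∈ T then φ x else 0
  have hψT : ∀ x ∉ T, ψ x = 0 := fun x hx => by simp [ψ, hx]
  have hψ0 : ∀ x, 0 ≤ ψ x := fun x => by
    by_cases hx : x ∈ T <;> simp [ψ, hx, hφ0 x]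
  have hψφ : ∀ x, ψ x ≤ φ x := fun x => by
    by_cases hx : x ∈ T <;> simp [ψ, hx, hφ0 x]
  have hψs : HasSum ψ (∑ x ∈ T, ψ x) := hasSum_sum_of_ne_finset_zero hψT
  have hψsum : ∑ x ∈ T, ψ x = ∑ x ∈ T, φ x :=
    Finset.sum_congr rfl fun x hx => by simp [ψ, hx]
  have hrest : HasSum (fun x => φ x - ψ x) (1 - ∑ x ∈ T, φ x) := by
    rw [← hψsum]
    exact hφ1.sub hψs
  have hmain := mul_sum_le_of_forall_mul_card_le H T ψ hψ0 hψT
  have hterm : ∀ g ∈ S, ∑' x, |ψ (g⁻¹ • x) - ψ x| ≤ 3 * η := by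
    intro g hg
    have hs := hφ1.summable.abs_translate_sub g
    have hrest' : HasSum (fun x => φ (g⁻¹ • x) - ψ (g⁻¹ • x)) (1 - ∑ x ∈ T, φ x) :=
      (Equiv.hasSum_iff (f := fun x => φ x - ψ x) (MulAction.toPerm g⁻¹)).2 hrest
    have hpt : ∀ x, |ψ (g⁻¹ • x) - ψ x| ≤
        |φ (g⁻¹ • x) - φ x| + (φ (g⁻¹ • x) - ψ (g⁻¹ • x)) + (φ x - ψ x) := fun x => by
      have h1 := hψφ (g⁻¹ • x)
      have h2 := hψφ x
      have h3 := abs_le.1 (le_refl |φ (g⁻¹ • x) - φ x|)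
      rw [abs_le]
      constructor <;> linarith
    have hle := hasSum_le hpt (hψs.summable.abs_translate_sub g).hasSum
      ((hs.hasSum.add hrest').add hrest)
    linarith [hφ g hg]
  have hS := Finset.sum_le_card_nsmul S _ _ hterm
  rw [nsmul_eq_mul] at hS
  rw [hψsum] at hmain
  have := mul_lt_mul_of_pos_left hT hε
  nlinarith

/-- **Theorem 2.2.** For an action of a discrete group `G` on a set `X`, the following
are equivalent: (1) the action admits an invariant mean; (2) Reiter's condition;
(3) Følner's condition. -/
theorem stmt2 {G X : Type*} [Group G] [MulAction G X] [DecidableEq X] :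
    (AmenableAction G X ↔ ReiterCondition G X) ∧
      (ReiterCondition G X ↔ FolnerCondition G X) := by
  exact ⟨⟨AmenableAction.reiterCondition, ReiterCondition.amenableAction⟩,
    ⟨ReiterCondition.folnerCondition, FolnerCondition.reiterCondition⟩⟩
end

section
/- Let G be a group acting on a set X. If the action is amenable and for every x ∈ X the stabilizer G_x of x in G is an amenable group, then the group G is amenable. -/
open MeasureTheory Filter Topology

/-- The integral of a simple function with respect to a finitely additive mean. -/
noncomputable def simpleIntegral {X : Type*} (μ : Set X → ℝ) (s : @SimpleFunc X ⊤ ℝ) : ℝ :=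
  @SimpleFunc.setToSimpleFunc X ℝ ℝ _ _ _ _ ⊤ (fun A => μ A • ContinuousLinearMap.id ℝ ℝ) s

section SimpleIntegral

variable {X : Type*} {μ : Set X → ℝ}

theorem simpleIntegral_add (hμ : IsMean μ) (s t : @SimpleFunc X ⊤ ℝ) :
    simpleIntegral μ (s + t) = simpleIntegral μ s + simpleIntegral μ t := by
  let _ : MeasurableSpace X := ⊤
  refine SimpleFunc.setToSimpleFunc_add (μ := 0) _ ?_
    (SimpleFunc.integrable_of_isFiniteMeasure s) (SimpleFunc.integrable_of_isFiniteMeasure t)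
  intro A B _ _ _ _ hAB
  simp only [hμ.additive A B hAB, add_smul]

theorem simpleIntegral_nonneg (hμ : IsMean μ) (s : @SimpleFunc X ⊤ ℝ) (hs : ∀ x, 0 ≤ s x) :
    0 ≤ simpleIntegral μ s := by
  let _ : MeasurableSpace X := ⊤
  refine SimpleFunc.setToSimpleFunc_nonneg _ (fun A x hx => ?_) s hs
  simpa using mul_nonneg (hμ.nonneg A) hx

theorem simpleIntegral_mono (hμ : IsMean μ) (s t : @SimpleFunc X ⊤ ℝ) (hst : ∀ x, s x ≤ t x) :
    simpleIntegral μ s ≤ simpleIntegral μ t := by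
  let _ : MeasurableSpace X := ⊤
  have h_nonneg := simpleIntegral_nonneg hμ (t - s) fun x => by simpa using hst x
  have h_add := simpleIntegral_add hμ s (t - s)
  rw [add_sub_cancel] at h_add
  linarith

theorem IsMean.empty (hμ : IsMean μ) : μ ∅ = 0 := by
  simpa using hμ.additive ∅ ∅ (by simp)

theorem simpleIntegral_const (hμ : IsMean μ) (c : ℝ) :
    simpleIntegral μ (@SimpleFunc.const X ℝ ⊤ c) = c := by
  let _ : MeasurableSpace X := ⊤
  refine (SimpleFunc.setToSimpleFunc_const _ (by simp [hμ.empty]) c).trans ?_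
  simp [hμ.total]

theorem simpleIntegral_comp_equiv (e : X ≃ X) (he : ∀ A, μ (e ⁻¹' A) = μ A)
    (s t : @SimpleFunc X ⊤ ℝ) (hst : ∀ x, t x = s (e x)) :
    simpleIntegral μ t = simpleIntegral μ s := by
  let _ : MeasurableSpace X := ⊤
  have h_fun : (t : X → ℝ) = s ∘ e := funext hst
  have h_range : t.range = s.range := by
    rw [← Finset.coe_inj, SimpleFunc.coe_range, SimpleFunc.coe_range, h_fun,
      e.surjective.range_comp]
  simp only [simpleIntegral, SimpleFunc.setToSimpleFunc, h_range, h_fun, Set.preimage_comp, he]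

end SimpleIntegral

/-- The integer part of `n • f`, cut off at `n`, as a simple function. -/
noncomputable def floorSimpleFunc {X : Type*} (f : X → ℝ) (n : ℕ) : @SimpleFunc X ⊤ ℝ :=
  @SimpleFunc.mk X ⊤ ℝ (fun x => ((min n ⌊n * f x⌋₊ : ℕ) : ℝ))
    (fun _ => MeasurableSpace.measurableSet_top)
    (((Set.finite_Iic n).image ((↑) : ℕ → ℝ)).subset (by
      rintro _ ⟨x, rfl⟩
      exact ⟨_, Set.mem_Iic.2 (min_le_left _ _), rfl⟩))

theorem floorSimpleFunc_apply {X : Type*} (f : X → ℝ) (n : ℕ) (x : X) :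
    floorSimpleFunc f n x = ((min n ⌊n * f x⌋₊ : ℕ) : ℝ) := rfl

theorem floorSimpleFunc_apply_of_le_one {X : Type*} {f : X → ℝ} (n : ℕ) {x : X} (hf : f x ≤ 1) :
    floorSimpleFunc f n x = (⌊n * f x⌋₊ : ℝ) := by
  rw [floorSimpleFunc_apply, min_eq_right]
  exact Nat.floor_le_of_le (mul_le_of_le_one_right n.cast_nonneg hf)

section MeanIntegral

variable {X : Type*} {μ : Set X → ℝ}

theorem simpleIntegral_floorSimpleFunc_mem_Icc (hμ : IsMean μ) (f : X → ℝ) (n : ℕ) :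
    simpleIntegral μ (floorSimpleFunc f n) / n ∈ Set.Icc (0 : ℝ) 1 := by
  let _ : MeasurableSpace X := ⊤
  refine ⟨div_nonneg (simpleIntegral_nonneg hμ _ fun x => ?_) n.cast_nonneg,
    div_le_one_of_le₀ ?_ n.cast_nonneg⟩
  · rw [floorSimpleFunc_apply]
    positivity
  · rw [← simpleIntegral_const hμ n]
    refine simpleIntegral_mono hμ _ _ fun x => ?_
    rw [floorSimpleFunc_apply]
    exact Nat.cast_le.2 (min_le_left _ _)

theorem simpleIntegral_floorSimpleFunc_add (hμ : IsMean μ) {f g : X → ℝ} (hf : ∀ x, 0 ≤ f x)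
    (hg : ∀ x, 0 ≤ g x) (hfg : ∀ x, f x + g x ≤ 1) (n : ℕ) :
    |simpleIntegral μ (floorSimpleFunc (f + g) n) -
      (simpleIntegral μ (floorSimpleFunc f n) + simpleIntegral μ (floorSimpleFunc g n))| ≤ 1 := by
  let _ : MeasurableSpace X := ⊤
  have h_fg (x : X) : floorSimpleFunc (f + g) n x = (⌊n * f x + n * g x⌋₊ : ℝ) := by
    rw [floorSimpleFunc_apply_of_le_one (f := f + g) n (hfg x), Pi.add_apply, mul_add]
  have h_f (x : X) : floorSimpleFunc f n x = (⌊n * f x⌋₊ : ℝ) :=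
    floorSimpleFunc_apply_of_le_one n (by linarith [hg x, hfg x])
  have h_g (x : X) : floorSimpleFunc g n x = (⌊n * g x⌋₊ : ℝ) :=
    floorSimpleFunc_apply_of_le_one n (by linarith [hf x, hfg x])
  have h_nonneg_f (x : X) : 0 ≤ n * f x := mul_nonneg n.cast_nonneg (hf x)
  have h_nonneg_g (x : X) : 0 ≤ n * g x := mul_nonneg n.cast_nonneg (hg x)
  have h_lower : simpleIntegral μ (floorSimpleFunc f n + floorSimpleFunc g n) ≤
      simpleIntegral μ (floorSimpleFunc (f + g) n) := by
    refine simpleIntegral_mono hμ _ _ fun x => ?_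
    rw [SimpleFunc.add_apply, h_fg, h_f, h_g]
    have h_le : ⌊n * f x⌋₊ + ⌊n * g x⌋₊ ≤ ⌊n * f x + n * g x⌋₊ := by
      refine Nat.le_floor ?_
      push_cast
      exact add_le_add (Nat.floor_le (h_nonneg_f x)) (Nat.floor_le (h_nonneg_g x))
    exact_mod_cast h_le
  have h_upper : simpleIntegral μ (floorSimpleFunc (f + g) n) ≤
      simpleIntegral μ (floorSimpleFunc f n + floorSimpleFunc g n + SimpleFunc.const X 1) := by
    refine simpleIntegral_mono hμ _ _ fun x => ?_
    rw [SimpleFunc.add_apply, SimpleFunc.add_apply, SimpleFunc.const_apply, h_fg, h_f, h_g]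
    have h_lt : ⌊n * f x + n * g x⌋₊ < ⌊n * f x⌋₊ + ⌊n * g x⌋₊ + 2 := by
      rw [Nat.floor_lt (add_nonneg (h_nonneg_f x) (h_nonneg_g x))]
      push_cast
      linarith [Nat.lt_floor_add_one (n * f x), Nat.lt_floor_add_one (n * g x)]
    exact_mod_cast Nat.le_of_lt_succ h_lt
  rw [simpleIntegral_add hμ, simpleIntegral_const hμ] at h_upper
  rw [simpleIntegral_add hμ] at h_lower h_upper
  rw [abs_le]
  constructor <;> linarith

/-- A mean extends to an integral on functions with values in `[0,1]`. -/
theorem IsMean.exists_integral (hμ : IsMean μ) :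
    ∃ I : (X → ℝ) → ℝ, (∀ f, I f ∈ Set.Icc (0 : ℝ) 1) ∧ I 1 = 1 ∧
      (∀ f g : X → ℝ, (∀ x, 0 ≤ f x) → (∀ x, 0 ≤ g x) → (∀ x, f x + g x ≤ 1) →
        I (f + g) = I f + I g) ∧
      ∀ e : X ≃ X, (∀ A, μ (e ⁻¹' A) = μ A) → ∀ f, I (f ∘ e) = I f := by
  let _ : MeasurableSpace X := ⊤
  let a (f : X → ℝ) (n : ℕ) : ℝ := simpleIntegral μ (floorSimpleFunc f n) / n
  let U : Ultrafilter ℕ := hyperfilter ℕ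
  have hU : (U : Filter ℕ) ≤ atTop := Nat.hyperfilter_le_atTop
  have h_lim (f : X → ℝ) : ∃ l ∈ Set.Icc (0 : ℝ) 1, Tendsto (a f) U (𝓝 l) :=
    isCompact_Icc.ultrafilter_le_nhds (U.map (a f)) (tendsto_principal.2 (.of_forall fun n =>
      simpleIntegral_floorSimpleFunc_mem_Icc hμ f n))
  choose I hI_mem hI using h_lim
  refine ⟨I, hI_mem, ?_, fun f g hf hg hfg => ?_, fun e he f => ?_⟩
  · refine tendsto_nhds_unique (hI 1) (tendsto_const_nhds.congr' ?_)
    filter_upwards [hU (eventually_gt_atTop 0)] with n hn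
    have h_const : floorSimpleFunc (1 : X → ℝ) n = SimpleFunc.const X (n : ℝ) := by
      ext x
      simp [floorSimpleFunc_apply]
    simp only [a, h_const, simpleIntegral_const hμ]
    rw [div_self (Nat.cast_ne_zero.2 hn.ne')]
  · have h_zero : Tendsto (fun n => a (f + g) n - (a f n + a g n)) U (𝓝 0) := by
      refine squeeze_zero_norm (fun n => ?_) (tendsto_one_div_atTop_nhds_zero_nat.mono_left hU)
      simp only [a, ← add_div, ← sub_div, norm_div, Real.norm_eq_abs, Nat.abs_cast]
      exact div_le_div_of_nonneg_right (simpleIntegral_floorSimpleFunc_add hμ hf hg hfg n)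
        n.cast_nonneg
    exact sub_eq_zero.1
      (tendsto_nhds_unique ((hI (f + g)).sub ((hI f).add (hI g))) h_zero)
  · refine tendsto_nhds_unique (hI (f ∘ e)) ((hI f).congr fun n => ?_)
    simp only [a]
    rw [simpleIntegral_comp_equiv e he (floorSimpleFunc f n) (floorSimpleFunc (f ∘ e) n) fun x => rfl]

end MeanIntegral

section Amenable

variable {G X : Type*} [Group G] [MulAction G X]

theorem isInvariantMean_iff_preimage {μ : Set X → ℝ} :
    IsInvariantMean G μ ↔ IsMean μ ∧ ∀ (g : G) (A : Set X), μ ((g • ·) ⁻¹' A) = μ A := by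
  refine and_congr_right fun _ => ⟨fun h g A => ?_, fun h g A => ?_⟩
  · rw [← h g ((g • ·) ⁻¹' A), Set.image_preimage_eq A (MulAction.surjective g)]
  · rw [← h g ((g • ·) '' A), Set.preimage_image_eq A (MulAction.injective g)]

theorem IsMean.preimage {Y : Type*} {μ : Set X → ℝ} (hμ : IsMean μ) (φ : X → Y) :
    IsMean fun A => μ (φ ⁻¹' A) where
  nonneg _ := hμ.nonneg _
  le_one _ := hμ.le_one _
  total := hμ.total
  additive _ _ hAB := hμ.additive _ _ (hAB.preimage φ)

/-- An amenable subgroup supports a mean on the ambient group that is invariant under it. -/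
theorem AmenableGroup.exists_mean_of_subgroup {H : Subgroup G} (hH : AmenableGroup H) :
    ∃ m : Set G → ℝ, IsMean m ∧ ∀ h ∈ H, ∀ A : Set G, m ((h * ·) ⁻¹' A) = m A := by
  obtain ⟨μ, hμ⟩ := hH
  rw [isInvariantMean_iff_preimage] at hμ
  exact ⟨_, hμ.1.preimage ((↑) : H → G), fun h hh A => hμ.2 ⟨h, hh⟩ (((↑) : H → G) ⁻¹' A)⟩

/-- If all stabilizers are amenable, there is an equivariant family of means on `G` indexed
by the points of `X`. -/
theorem exists_equivariant_means (h_stab : ∀ x : X, AmenableGroup (MulAction.stabilizer G x)) :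
    ∃ ν : X → Set G → ℝ, (∀ x, IsMean (ν x)) ∧
      ∀ (g : G) (x : X) (A : Set G), ν x ((g * ·) ⁻¹' A) = ν (g • x) A := by
  choose m hm hm_inv using fun x => (h_stab x).exists_mean_of_subgroup
  let r (x : X) : X := (Quotient.mk (MulAction.orbitRel G X) x).out
  have hr (x : X) : ∃ g : G, g • r x = x :=
    (MulAction.orbitRel G X).symm (Quotient.mk_out (s := MulAction.orbitRel G X) x)
  have hr_smul (g : G) (x : X) : r (g • x) = r x :=
    congrArg Quotient.out (Quotient.sound (s := MulAction.orbitRel G X) ⟨g, rfl⟩)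
  choose γ hγ using hr
  refine ⟨fun x A => m (r x) ((γ x * ·) ⁻¹' A), fun x => (hm (r x)).preimage _, fun g x A => ?_⟩
  have h_mem : (γ (g • x))⁻¹ * (g * γ x) ∈ MulAction.stabilizer G (r x) := by
    rw [MulAction.mem_stabilizer_iff, mul_smul, mul_smul, hγ, inv_smul_eq_iff, ← hr_smul g x, hγ]
  simp only [hr_smul]
  rw [← hm_inv (r x) _ h_mem ((γ (g • x) * ·) ⁻¹' A)]
  congr 1
  ext k
  simp [mul_assoc]

end Amenable

/-- **Proposition 2.4.** If a group `G` acts amenably (i.e. with an invariant mean) on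
a set `X` and the stabilizer of every point of `X` is an amenable group, then `G` is
amenable. -/
theorem stmt3 {G X : Type*} [Group G] [MulAction G X]
    (h_action : AmenableAction G X)
    (h_stab : ∀ x : X, AmenableGroup (MulAction.stabilizer G x)) :
    AmenableGroup G := by
  obtain ⟨μ, hμ⟩ := h_action
  rw [isInvariantMean_iff_preimage] at hμ
  obtain ⟨I, hI_mem, hI_one, hI_add, hI_comp⟩ := hμ.1.exists_integral
  obtain ⟨ν, hν, hν_smul⟩ := exists_equivariant_means h_stab
  refine ⟨fun A => I fun x => ν x A, isInvariantMean_iff_preimage.2 ⟨⟨fun A => (hI_mem _).1,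
    fun A => (hI_mem _).2, ?_, fun A B hAB => ?_⟩, fun g A => ?_⟩⟩
  · simp only [(hν _).total]
    exact hI_one
  · have h_union (x : X) : ν x (A ∪ B) = ν x A + ν x B := (hν x).additive A B hAB
    simp only [h_union]
    exact hI_add _ _ (fun x => (hν x).nonneg A) (fun x => (hν x).nonneg B)
      fun x => h_union x ▸ (hν x).le_one _
  · simp only [smul_eq_mul, hν_smul]
    exact hI_comp (MulAction.toPerm g) (hμ.2 g) fun x => ν x A
end

section
/- If the action of a finitely generated group G on a set X is recurrent, and H < G is a finitely generated subgroup, then the action of H on every one of its orbits in X is also recurrent. -/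
/-- The contribution of a single group element to the Dirichlet energy. -/
noncomputable def elementEnergy {G X : Type*} [Group G] [MulAction G X]
    (g : G) (a : X →₀ ℝ) : ℝ :=
  ∑ᶠ x : X, (a x - a (g • x)) ^ 2

section Energy

variable {G X : Type*} [Group G] [MulAction G X]

theorem finite_support_sq_sub_smul (g : G) (a : X →₀ ℝ) :
    (Function.support fun x : X => (a x - a (g • x)) ^ 2).Finite := by
  have hpre : ((g • ·) ⁻¹' (a.support : Set X)).Finite :=
    a.support.finite_toSet.preimage (MulAction.injective g).injOn
  refine (a.support.finite_toSet.union hpre).subset fun x hx => ?_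
  by_contra h
  simp only [Set.mem_union, Set.mem_preimage, Finset.mem_coe, Finsupp.mem_support_iff,
    not_or, not_not] at h
  exact hx (by simp [h.1, h.2])

theorem elementEnergy_nonneg (g : G) (a : X →₀ ℝ) : 0 ≤ elementEnergy g a :=
  finsum_nonneg fun _ => sq_nonneg _

theorem schreierEnergy_eq_sum (S : Finset G) (a : X →₀ ℝ) :
    schreierEnergy S a = ∑ g ∈ S, elementEnergy g a :=
  finsum_sum_comm S _ fun g _ => finite_support_sq_sub_smul g a

theorem elementEnergy_one (a : X →₀ ℝ) : elementEnergy (1 : G) a = 0 := by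
  simp [elementEnergy]

theorem elementEnergy_inv (g : G) (a : X →₀ ℝ) :
    elementEnergy g⁻¹ a = elementEnergy g a := by
  unfold elementEnergy
  rw [← finsum_comp_equiv (MulAction.toPerm g)]
  refine finsum_congr fun x => ?_
  simp only [MulAction.toPerm_apply, inv_smul_smul]
  ring

theorem elementEnergy_mul_le (g h : G) (a : X →₀ ℝ) :
    elementEnergy (g * h) a ≤ 2 * elementEnergy g a + 2 * elementEnergy h a := by
  have hg : elementEnergy g a = ∑ᶠ x : X, (a (h • x) - a (g • h • x)) ^ 2 :=
    (finsum_comp_equiv (MulAction.toPerm h) (f := fun x => (a x - a (g • x)) ^ 2)).symm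
  have hfg : (Function.support fun x : X => 2 * (a (h • x) - a (g • h • x)) ^ 2).Finite :=
    ((finite_support_sq_sub_smul g a).preimage (MulAction.injective h).injOn).subset
      fun _ hx => right_ne_zero_of_mul hx
  have hfh : (Function.support fun x : X => 2 * (a x - a (h • x)) ^ 2).Finite :=
    (finite_support_sq_sub_smul h a).subset fun _ hx => right_ne_zero_of_mul hx
  rw [hg, elementEnergy, elementEnergy, mul_finsum, mul_finsum, ← finsum_add_distrib hfg hfh]
  refine finsum_le_finsum' (finite_support_sq_sub_smul _ a)
    ((hfg.union hfh).subset (Function.support_add _ _)) fun x => ?_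
  simp only [mul_smul]
  nlinarith [sq_nonneg ((a (h • x) - a (g • h • x)) - (a x - a (h • x)))]

/-- The energy of any group element is controlled by the energy of a generating set. -/
theorem exists_elementEnergy_le_mul_schreierEnergy (X : Type*) [MulAction G X] {S : Finset G}
    (hS : Subgroup.closure (S : Set G) = ⊤) (g : G) :
    ∃ C : ℝ, 0 ≤ C ∧ ∀ a : X →₀ ℝ, elementEnergy g a ≤ C * schreierEnergy S a := by
  have hg : g ∈ Subgroup.closure (S : Set G) := hS ▸ Subgroup.mem_top g
  induction hg using Subgroup.closure_induction with
  | mem g hg =>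
    refine ⟨1, zero_le_one, fun a => ?_⟩
    rw [one_mul, schreierEnergy_eq_sum]
    exact Finset.single_le_sum (f := fun g => elementEnergy g a)
      (fun g _ => elementEnergy_nonneg g a) hg
  | one => exact ⟨0, le_rfl, fun a => by simp [elementEnergy_one]⟩
  | mul g h _ _ ihg ihh =>
    obtain ⟨C, hC, hCg⟩ := ihg
    obtain ⟨D, hD, hDh⟩ := ihh
    refine ⟨2 * C + 2 * D, by positivity, fun a => ?_⟩
    linarith [elementEnergy_mul_le g h a, hCg a, hDh a]
  | inv g _ ih =>
    obtain ⟨C, hC, hCg⟩ := ih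
    exact ⟨C, hC, fun a => (elementEnergy_inv g a).trans_le (hCg a)⟩

/-- Restricting a function to an orbit does not increase its energy. -/
theorem elementEnergy_filter_orbit_le (x₀ : X) [DecidablePred (· ∈ MulAction.orbit G x₀)]
    (g : G) (a : X →₀ ℝ) :
    elementEnergy g (a.filter (· ∈ MulAction.orbit G x₀)) ≤ elementEnergy g a := by
  refine finsum_le_finsum' (finite_support_sq_sub_smul _ _) (finite_support_sq_sub_smul _ _)
    fun x => ?_
  have hmem : g • x ∈ MulAction.orbit G x₀ ↔ x ∈ MulAction.orbit G x₀ := by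
    rw [← MulAction.orbit_eq_iff, ← MulAction.orbit_eq_iff, MulAction.orbit_smul]
  simp only [Finsupp.filter_apply, hmem]
  split_ifs
  · exact le_rfl
  · simpa using sq_nonneg (a x - a (g • x))

end Energy

/-- **Lemma 2.5.** If the action of a finitely generated group `G` (with finite
symmetric generating set `S`) on a set `X` is recurrent, and `H < G` is a finitely
generated subgroup (with finite symmetric generating set `T`), then the action of `H`
on each of its orbits in `X` is recurrent. -/
theorem stmt4 {G X : Type*} [Group G] [MulAction G X] [MulAction.IsPretransitive G X]
    (S : Finset G) (hS : IsSymmGen S)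
    (hrec : ∀ x₀ : X, SchreierRecurrentAt G S x₀)
    (H : Subgroup G) (T : Finset H) (hT : IsSymmGen T) :
    ∀ x : X, SchreierRecurrentAt H T x := by
  classical
  intro x ε hε
  choose C hC hCle using fun h : H =>
    exists_elementEnergy_le_mul_schreierEnergy X hS.2 (h : G)
  have hsum : 0 ≤ ∑ h ∈ T, C h := Finset.sum_nonneg fun h _ => hC h
  obtain ⟨a, -, hax, ha⟩ := hrec x (ε / (∑ h ∈ T, C h + 1)) (by positivity)
  have hnonneg : 0 ≤ schreierEnergy S a :=
    (schreierEnergy_eq_sum S a).symm ▸ Finset.sum_nonneg fun g _ => elementEnergy_nonneg g a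
  refine ⟨a.filter (· ∈ MulAction.orbit H x), fun y hy => ?_, ?_, ?_⟩
  · simp only [Finset.mem_coe, Finsupp.support_filter, Finset.mem_filter] at hy
    exact hy.2
  · rw [Finsupp.filter_apply_pos _ _ (MulAction.mem_orbit_self x), hax]
  · calc schreierEnergy T (a.filter (· ∈ MulAction.orbit H x))
        ≤ ∑ h ∈ T, C h * schreierEnergy S a := by
          rw [schreierEnergy_eq_sum]
          exact Finset.sum_le_sum fun h _ =>
            (elementEnergy_filter_orbit_le x h a).trans (hCle h a)
      _ ≤ schreierEnergy S a * (∑ h ∈ T, C h + 1) := by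
          rw [← Finset.sum_mul]
          linarith
      _ < ε := (lt_div_iff₀ (by positivity)).1 ha
end

section
/- Let Γ be a connected graph of uniformly bounded vertex degree with vertex set V. Suppose there exists an increasing sequence of finite subsets F_n ⊆ V with ∪_{n≥1} F_n = V, such that the sets ∂F_n are pairwise disjoint and Σ_{n≥1} 1/|∂F_n| = ∞, where ∂F_n is the set of vertices of F_n adjacent to vertices of V \ F_n. Then the simple random walk on Γ is recurrent. -/
open scoped Classical

/-- The Dirichlet energy of a finitely supported function `a` on the vertex set of a
graph `Γ` (each edge contributes twice, as the ordered pairs `(x,y)` and `(y,x)`). -/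
noncomputable def graphEnergy {V : Type*} (Γ : SimpleGraph V) (a : V →₀ ℝ) : ℝ :=
  ∑ᶠ p : V × V, if Γ.Adj p.1 p.2 then (a p.1 - a p.2) ^ 2 else 0

/-- Recurrence of the simple random walk on a connected locally finite graph `Γ`,
expressed through the capacity criterion: the walk is recurrent if and only if the
capacity of a vertex `x₀` vanishes, i.e. there exist finitely supported functions
taking the value `1` at `x₀` of arbitrarily small Dirichlet energy (Woess, "Random
walks on infinite graphs and groups", Theorem 2.12). -/
def SimpleGraph.RecurrentWalk {V : Type*} (Γ : SimpleGraph V) : Prop :=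
  ∀ (x₀ : V) (ε : ℝ), 0 < ε → ∃ a : V →₀ ℝ, a x₀ = 1 ∧ graphEnergy Γ a < ε

/-- The (inner) vertex boundary of a finite set `F` of vertices: the vertices of `F`
adjacent to a vertex outside `F`. -/
def vertexBoundary {V : Type*} (Γ : SimpleGraph V) (F : Finset V) : Set V :=
  {v | v ∈ F ∧ ∃ u, Γ.Adj v u ∧ u ∉ F}

/-- The ordered pairs of adjacent vertices separated by `F` lie in a finite set of at most
`2 * (|∂F| * D)` pairs if all degrees are at most `D`. -/
theorem exists_finset_separated_pairs {V : Type*} (Γ : SimpleGraph V)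
    (hlf : ∀ v : V, (Γ.neighborSet v).Finite)
    (D : ℕ) (hdeg : ∀ v : V, (Γ.neighborSet v).ncard ≤ D) (F : Finset V) :
    ∃ R : Finset (V × V), R.card ≤ 2 * ((vertexBoundary Γ F).ncard * D) ∧
      ∀ x y, Γ.Adj x y → ¬ (x ∈ F ↔ y ∈ F) → (x, y) ∈ R := by
  have hfin : (vertexBoundary Γ F).Finite := F.finite_toSet.subset fun v hv => hv.1
  let Q : Finset (V × V) := hfin.toFinset.biUnion fun v => (hlf v).toFinset.image (Prod.mk v)
  have hQ : Q.card ≤ (vertexBoundary Γ F).ncard * D := by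
    rw [Set.ncard_eq_toFinset_card _ hfin]
    refine Finset.card_biUnion_le_card_mul _ _ _ fun v _ => Finset.card_image_le.trans ?_
    rw [← Set.ncard_eq_toFinset_card _ (hlf v)]
    exact hdeg v
  have hmem : ∀ x y, Γ.Adj x y → x ∈ F → y ∉ F → (x, y) ∈ Q := fun x y hxy hx hy =>
    Finset.mem_biUnion.2 ⟨x, hfin.mem_toFinset.2 ⟨hx, y, hxy, hy⟩,
      Finset.mem_image.2 ⟨y, (hlf x).mem_toFinset.2 hxy, rfl⟩⟩
  refine ⟨Q ∪ Q.image Prod.swap, ?_, fun x y hxy hne => ?_⟩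
  · have h₁ := Finset.card_union_le Q (Q.image Prod.swap)
    have h₂ : (Q.image Prod.swap).card ≤ Q.card := Finset.card_image_le
    omega
  · by_cases hx : x ∈ F
    · have hy : y ∉ F := fun hy => hne ⟨fun _ => hy, fun _ => hx⟩
      exact Finset.mem_union_left _ (hmem x y hxy hx hy)
    · have hy : y ∈ F := by tauto
      exact Finset.mem_union_right _
        (Finset.mem_image.2 ⟨(y, x), hmem y x hxy.symm hy hx, rfl⟩)

/-- The square of a sum of pairwise orthogonal terms is the sum of the squares. -/
theorem sq_sum_eq_sum_sq_of_pairwise_mul_eq_zero {ι : Type*} (s : Finset ι) (f : ι → ℝ)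
    (h : ∀ m n, m ≠ n → f m * f n = 0) : (∑ n ∈ s, f n) ^ 2 = ∑ n ∈ s, f n ^ 2 := by
  rw [sq, Finset.sum_mul_sum]
  refine Finset.sum_congr rfl fun m hm => ?_
  rw [Finset.sum_eq_single_of_mem m hm fun n _ hn => h m n hn.symm, sq]

/-- A finite sum of weighted indicators of an increasing family of finite sets with pairwise
disjoint boundaries has energy at most `2 * D * ∑ |∂F n| * d n ^ 2`. -/
theorem graphEnergy_le_of_disjoint_boundaries {V : Type*} (Γ : SimpleGraph V)
    (hlf : ∀ v : V, (Γ.neighborSet v).Finite)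
    (D : ℕ) (hdeg : ∀ v : V, (Γ.neighborSet v).ncard ≤ D)
    (F : ℕ → Finset V) (hmono : Monotone F)
    (hdisj : Pairwise fun m n => Disjoint (vertexBoundary Γ (F m)) (vertexBoundary Γ (F n)))
    (s : Finset ℕ) (d : ℕ → ℝ) (a : V →₀ ℝ)
    (ha : ∀ v, a v = ∑ n ∈ s, if v ∈ F n then d n else 0) :
    graphEnergy Γ a ≤ ∑ n ∈ s, d n ^ 2 * (2 * ((vertexBoundary Γ (F n)).ncard * D)) := by
  choose R hcard hR using fun n => exists_finset_separated_pairs Γ hlf D hdeg (F n)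
  have key : ∀ p : V × V, (if Γ.Adj p.1 p.2 then (a p.1 - a p.2) ^ 2 else 0) ≤
      ∑ n ∈ s, if p ∈ R n then d n ^ 2 else 0 := by
    rintro ⟨x, y⟩
    by_cases hxy : Γ.Adj x y
    · rw [if_pos hxy]
      simp only [ha]
      rw [← Finset.sum_sub_distrib, sq_sum_eq_sum_sq_of_pairwise_mul_eq_zero]
      · refine Finset.sum_le_sum fun n _ => ?_
        have hRn := hR n x y hxy
        by_cases hx : x ∈ F n <;> by_cases hy : y ∈ F n <;> simp [hx, hy] at hRn ⊢ <;>
          first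
          | simp [hRn]
          | (split_ifs <;> positivity)
      · intro m n hmn
        have hd : ∀ u v, Γ.Adj u v → u ∈ F m → v ∉ F m → u ∈ F n → v ∉ F n → False :=
          fun u v huv h₁ h₂ h₃ h₄ =>
            Set.disjoint_left.1 (hdisj hmn) ⟨h₁, v, huv, h₂⟩ ⟨h₃, v, huv, h₄⟩
        have hc : ∀ u v, u ∈ F m → v ∉ F m → v ∈ F n → u ∉ F n → False :=
          fun u v h₁ h₂ h₃ h₄ => (le_total m n).elim (fun h => h₄ (hmono h h₁))
            fun h => h₂ (hmono h h₃)
        have h₁ := hd x y hxy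
        have h₂ := hd y x hxy.symm
        have h₃ := hc x y
        have h₄ := hc y x
        clear hd hc
        by_cases x ∈ F m <;> by_cases y ∈ F m <;> by_cases x ∈ F n <;> by_cases y ∈ F n <;>
          simp_all
    · rw [if_neg hxy]
      exact Finset.sum_nonneg fun n _ => by split_ifs <;> positivity
  have hnonneg : ∀ p : V × V, 0 ≤ (if Γ.Adj p.1 p.2 then (a p.1 - a p.2) ^ 2 else 0) :=
    fun p => by split_ifs <;> positivity
  have hsupp : Function.support
      (fun p : V × V => if Γ.Adj p.1 p.2 then (a p.1 - a p.2) ^ 2 else 0) ⊆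
        ((s.biUnion R : Finset (V × V)) : Set (V × V)) := by
    intro p hp
    by_contra hpR
    refine hp (le_antisymm ((key p).trans (Finset.sum_nonpos fun n hn => ?_)) (hnonneg p))
    rw [if_neg fun h => hpR (Finset.mem_coe.2 (Finset.mem_biUnion.2 ⟨n, hn, h⟩))]
  rw [graphEnergy, finsum_eq_sum_of_support_subset _ hsupp]
  refine (Finset.sum_le_sum fun p _ => key p).trans ?_
  rw [Finset.sum_comm]
  refine Finset.sum_le_sum fun n hn => ?_
  rw [← Finset.sum_filter, Finset.sum_const, nsmul_eq_mul, mul_comm]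
  refine mul_le_mul_of_nonneg_left ?_ (sq_nonneg _)
  have hsub : ((s.biUnion R).filter (· ∈ R n)).card ≤ (R n).card :=
    Finset.card_le_card fun p hp => (Finset.mem_filter.1 hp).2
  exact_mod_cast hsub.trans (hcard n)

/-- **Theorem 2.6 (Nash–Williams criterion).** Let `Γ` be a connected graph of
uniformly bounded degree with vertex set `V`. Suppose there is an increasing sequence
of finite sets `F n ⊆ V` exhausting `V` whose boundaries `∂F n` are pairwise disjoint
and satisfy `∑ 1/|∂F n| = ∞`. Then the simple random walk on `Γ` is recurrent. -/
theorem stmt5 {V : Type*} (Γ : SimpleGraph V) (hconn : Γ.Connected)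
    (hlf : ∀ v : V, (Γ.neighborSet v).Finite)
    (D : ℕ) (hdeg : ∀ v : V, (Γ.neighborSet v).ncard ≤ D)
    (F : ℕ → Finset V) (hmono : Monotone F)
    (hcover : ∀ v : V, ∃ n, v ∈ F n)
    (hdisj : Pairwise fun m n => Disjoint (vertexBoundary Γ (F m)) (vertexBoundary Γ (F n)))
    (hdiv : Filter.Tendsto
      (fun N => ∑ n ∈ Finset.range N, (1 : ℝ) / (vertexBoundary Γ (F n)).ncard)
      Filter.atTop Filter.atTop) :
    Γ.RecurrentWalk := by
  intro x₀ ε hε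
  obtain ⟨k, hk⟩ := hcover x₀
  set c : ℕ → ℝ := fun n => 1 / ((vertexBoundary Γ (F n)).ncard : ℝ) with hc
  obtain ⟨N, hN, hkN⟩ := ((hdiv.eventually_ge_atTop
    (∑ n ∈ Finset.range k, c n + (2 * D / ε + 1))).and (Filter.eventually_ge_atTop k)).exists
  set S : ℝ := ∑ n ∈ Finset.Ico k N, c n with hS
  have hSge : 2 * D / ε + 1 ≤ S := by
    rw [hS, Finset.sum_Ico_eq_sub _ hkN]
    linarith
  have hSpos : 0 < S := lt_of_lt_of_le (by positivity) hSge
  let a : V →₀ ℝ := Finsupp.onFinset (F N)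
    (fun v => ∑ n ∈ Finset.Ico k N, if v ∈ F n then c n / S else 0) fun v hv => by
      obtain ⟨n, hn, hne⟩ := Finset.exists_ne_zero_of_sum_ne_zero hv
      exact hmono (Finset.mem_Ico.1 hn).2.le (by_contra fun h => hne (if_neg h))
  refine ⟨a, ?_, (graphEnergy_le_of_disjoint_boundaries Γ hlf D hdeg F hmono hdisj
    (Finset.Ico k N) (fun n => c n / S) a fun v => rfl).trans_lt ?_⟩
  · change ∑ n ∈ Finset.Ico k N, (if x₀ ∈ F n then c n / S else 0) = 1
    rw [Finset.sum_congr rfl fun n hn => if_pos (hmono (Finset.mem_Ico.1 hn).1 hk),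
      ← Finset.sum_div, ← hS, div_self hSpos.ne']
  · have hterm : ∀ n, (c n / S) ^ 2 * (2 * ((vertexBoundary Γ (F n)).ncard * D)) =
        c n * (2 * D / S ^ 2) := by
      intro n
      simp only [hc]
      by_cases h : ((vertexBoundary Γ (F n)).ncard : ℝ) = 0
      · simp [h]
      · field_simp
    rw [Finset.sum_congr rfl fun n _ => hterm n, ← Finset.sum_mul, ← hS]
    have hlt : 2 * D / ε < S := by linarith
    rw [div_lt_iff₀ hε] at hlt
    have heq : S * (2 * D / S ^ 2) = 2 * D / S := by field_simp
    rw [heq, div_lt_iff₀ hSpos]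
    linarith
end
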